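/- Let f : ℝ⁶ → ℝ be given by f(x) = sin(2πx₂). Then the field of 3-forms ω^f on ℝ⁶ is invariant under translation by every vector of the integer lattice ℤ⁶ (i.e. ω^f_{p+k} = ω^f_p for all p ∈ ℝ⁶ and k ∈ ℤ⁶), yet ω^f does not have constant linear type: there exist points p, q ∈ ℝ⁶ such that no linear isomorphism g : ℝ⁶ → ℝ⁶ satisfies g*(ω^f_q) = ω^f_p. -/

import Mathlib

/-- `dx3 i j k` is the alternating 3-form `dxⁱ ∧ dxʲ ∧ dxᵏ` on `ℝ⁶ = Fin 6 → ℝ`. -/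
noncomputable def dx3 (i j k : Fin 6) : AlternatingMap ℝ (Fin 6 → ℝ) ℝ (Fin 3) :=
  (Matrix.detRowAlternating : AlternatingMap ℝ (Fin 3 → ℝ) ℝ (Fin 3)).compLinearMap
    (LinearMap.funLeft ℝ ℝ ![i, j, k])

/-- For `f : ℝ⁶ → ℝ`, the field of 3-forms
`ω^f_p = dx^{135} − dx^{146} − dx^{236} + f(p)·dx^{245}` on `ℝ⁶`. -/
noncomputable def omegaF (f : (Fin 6 → ℝ) → ℝ) (p : Fin 6 → ℝ) :
    AlternatingMap ℝ (Fin 6 → ℝ) ℝ (Fin 3) :=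
  dx3 0 2 4 - dx3 0 3 5 - dx3 1 2 5 + f p • dx3 1 3 4

theorem dx3_apply (i j k : Fin 6) (u v w : Fin 6 → ℝ) :
    dx3 i j k ![u, v, w] =
      u i * (v j * w k - v k * w j) - u j * (v i * w k - v k * w i)
        + u k * (v i * w j - v j * w i) := by
  have h : dx3 i j k ![u, v, w] =
      Matrix.det (Matrix.of fun a b : Fin 3 => (![u, v, w] a) (![i, j, k] b)) := rfl
  rw [h, Matrix.det_fin_three]
  simp
  ring

theorem omegaF_apply (f : (Fin 6 → ℝ) → ℝ) (p : Fin 6 → ℝ) (v : Fin 3 → Fin 6 → ℝ) :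
    omegaF f p v = dx3 0 2 4 v - dx3 0 3 5 v - dx3 1 2 5 v + f p * dx3 1 3 4 v := rfl

/-- The value on `(w, x, y, z)` of (half) the square of the 2-form `ι_u ω`; it vanishes
identically exactly when `ι_u ω` has rank at most two. -/
def contractionPfaffian (ω : AlternatingMap ℝ (Fin 6 → ℝ) ℝ (Fin 3)) (u w x y z : Fin 6 → ℝ) : ℝ :=
  ω ![u, w, x] * ω ![u, y, z] - ω ![u, w, y] * ω ![u, x, z] + ω ![u, w, z] * ω ![u, x, y]

theorem contractionPfaffian_compLinearMap (ω : AlternatingMap ℝ (Fin 6 → ℝ) ℝ (Fin 3))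
    (g : (Fin 6 → ℝ) →ₗ[ℝ] (Fin 6 → ℝ)) (u w x y z : Fin 6 → ℝ) :
    contractionPfaffian (ω.compLinearMap g) u w x y z =
      contractionPfaffian ω (g u) (g w) (g x) (g y) (g z) := by
  have h (a b c : Fin 6 → ℝ) : (ω.compLinearMap g) ![a, b, c] = ω ![g a, g b, g c] := by
    rw [AlternatingMap.compLinearMap_apply]
    congr 1
    ext i
    fin_cases i <;> rfl
  simp only [contractionPfaffian, h]

theorem contractionPfaffian_omegaF_of_eq_zero {f : (Fin 6 → ℝ) → ℝ} {p : Fin 6 → ℝ}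
    (hp : f p = 0) (w x y z : Fin 6 → ℝ) :
    contractionPfaffian (omegaF f p) (Pi.single 4 1) w x y z = 0 := by
  simp [contractionPfaffian, omegaF_apply, dx3_apply, hp]
  ring

theorem eq_zero_of_contractionPfaffian_omegaF {f : (Fin 6 → ℝ) → ℝ} {q u : Fin 6 → ℝ}
    (hq : f q = -1) (h : ∀ w x y z, contractionPfaffian (omegaF f q) u w x y z = 0) : u = 0 := by
  have h₁ := h (Pi.single 0 1) (Pi.single 1 1) (Pi.single 2 1) (Pi.single 3 1)
  have h₂ := h (Pi.single 0 1) (Pi.single 1 1) (Pi.single 4 1) (Pi.single 5 1)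
  have h₃ := h (Pi.single 2 1) (Pi.single 3 1) (Pi.single 4 1) (Pi.single 5 1)
  simp [contractionPfaffian, omegaF_apply, dx3_apply, hq] at h₁ h₂ h₃
  ext i
  fin_cases i <;> simp <;> nlinarith

/-- For `f(x) = sin(2πx₂)`, the field `ω^f` is invariant under translations by the
integer lattice `ℤ⁶`, yet it does not have constant linear type. -/
theorem periodic_omegaF_nonconstant_type :
    (∀ (p : Fin 6 → ℝ) (k : Fin 6 → ℤ),
        omegaF (fun x => Real.sin (2 * Real.pi * x 1)) (p + fun i => (k i : ℝ)) =
          omegaF (fun x => Real.sin (2 * Real.pi * x 1)) p) ∧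
    ∃ p q : Fin 6 → ℝ,
      ¬ ∃ g : (Fin 6 → ℝ) ≃ₗ[ℝ] (Fin 6 → ℝ),
          (omegaF (fun x => Real.sin (2 * Real.pi * x 1)) q).compLinearMap
              (g : (Fin 6 → ℝ) →ₗ[ℝ] (Fin 6 → ℝ)) =
            omegaF (fun x => Real.sin (2 * Real.pi * x 1)) p := by
  refine ⟨fun p k => ?_, 0, fun _ => -(1 / 4), ?_⟩
  · have h : Real.sin (2 * Real.pi * (p 1 + k 1)) = Real.sin (2 * Real.pi * p 1) := by
      rw [← Real.sin_add_int_mul_two_pi (2 * Real.pi * p 1) (k 1)]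
      ring_nf
    simp only [omegaF, Pi.add_apply, h]
  · rintro ⟨g, hg⟩
    have hq : Real.sin (2 * Real.pi * -(1 / 4)) = -1 := by
      rw [show 2 * Real.pi * -(1 / 4) = -(Real.pi / 2) by ring, Real.sin_neg, Real.sin_pi_div_two]
    have hu : g (Pi.single 4 1) = 0 := by
      refine eq_zero_of_contractionPfaffian_omegaF
        (f := fun x => Real.sin (2 * Real.pi * x 1)) (q := fun _ => -(1 / 4)) hq fun w x y z => ?_
      have h := contractionPfaffian_omegaF_of_eq_zero
        (f := fun x => Real.sin (2 * Real.pi * x 1)) (p := 0) (by simp)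
        (g.symm w) (g.symm x) (g.symm y) (g.symm z)
      rw [← hg, contractionPfaffian_compLinearMap] at h
      simpa using h
    have h4 := congrFun ((map_eq_zero_iff g g.injective).mp hu) 4
    simp at h4
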